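/- arXiv:2103.03795 — 4 statements merged into one kernel-verified Lean document; each statement's English description precedes it below -/
import Mathlib

section
/- Let G be a finite connected simple graph and let f be a partial proper 2-coloring of G. Then f can be extended to a (total) proper 2-coloring of all the vertices of G if and only if all of the following hold: (1) there is no induced path of even length whose only colored vertices are its two endpoints and whose endpoints are colored with distinct colors; (2) there is no induced path of odd length whose only colored vertices are its two endpoints and whose endpoints are colored with the same color; (3) there is no induced odd cycle all of whose vertices are uncolored; (4) there is no induced odd cycle with exactly one colored vertex; (5) there is no induced odd cycle with exactly two colored vertices which are adjacent. -/
/-- A partial 2-coloring (with colors `Bool`) is proper: no two adjacent vertices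
receive the same color. -/
def PartialProper {V : Type*} (G : SimpleGraph V) (f : V → Option Bool) : Prop :=
  ∀ u v, G.Adj u v → ∀ c, f u = some c → f v ≠ some c

/-- A total 2-coloring `g` extends the partial coloring `f`. -/
def ExtendsColoring {V : Type*} (f : V → Option Bool) (g : V → Bool) : Prop :=
  ∀ v c, f v = some c → g v = c

/-- A total 2-coloring is proper. -/
def TotalProper {V : Type*} (G : SimpleGraph V) (g : V → Bool) : Prop :=
  ∀ u v, G.Adj u v → g u ≠ g v

/-- `p` lists the vertices of an induced path of length `k` in `G`: the vertices are
pairwise distinct, consecutive ones are adjacent, and non-consecutive ones are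
non-adjacent. -/
def IsInducedPath {V : Type*} (G : SimpleGraph V) (k : ℕ) (p : Fin (k + 1) → V) : Prop :=
  Function.Injective p ∧
  (∀ i : Fin k, G.Adj (p i.castSucc) (p i.succ)) ∧
  (∀ i j : Fin (k + 1), i.val + 1 < j.val → ¬ G.Adj (p i) (p j))

/-- `c` lists the vertices of an induced cycle of length `k` in `G`: `k ≥ 3`, the
vertices are pairwise distinct, cyclically consecutive ones are adjacent, and
non-consecutive ones are non-adjacent. -/
def IsInducedCycle {V : Type*} (G : SimpleGraph V) (k : ℕ) (c : ZMod k → V) : Prop :=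
  3 ≤ k ∧ Function.Injective c ∧
  (∀ i : ZMod k, G.Adj (c i) (c (i + 1))) ∧
  (∀ i j : ZMod k, i ≠ j → j ≠ i + 1 → i ≠ j + 1 → ¬ G.Adj (c i) (c j))

namespace SimpleGraph

variable {V : Type*} {G : SimpleGraph V}

/-- Along a sequence of adjacent vertices, a proper 2-coloring alternates. -/
lemma color_eq_iff_even_of_adj {g : V → Bool} (hg : TotalProper G g) {D : ℕ → V} {N : ℕ}
    (hD : ∀ n < N, G.Adj (D n) (D (n + 1))) {n : ℕ} (hn : n ≤ N) :
    g (D n) = g (D 0) ↔ Even n := by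
  induction n with
  | zero => simp
  | succ n ih =>
    have h := hg _ _ (hD n (by lia))
    rw [Nat.even_add_one, ← ih (by lia)]
    revert h
    cases g (D n) <;> cases g (D (n + 1)) <;> cases g (D 0) <;> simp

lemma color_last_eq_iff_even {g : V → Bool} (hg : TotalProper G g) {k : ℕ}
    {p : Fin (k + 1) → V} (hp : IsInducedPath G k p) :
    g (p (Fin.last k)) = g (p 0) ↔ Even k := by
  have hD : ∀ n < k, G.Adj (p (Fin.ofNat (k + 1) n)) (p (Fin.ofNat (k + 1) (n + 1))) := by
    intro n hn
    convert hp.2.1 ⟨n, hn⟩ using 2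
    · ext; simp; lia
    · ext; simp; lia
  have h := color_eq_iff_even_of_adj hg (D := fun n => p (Fin.ofNat (k + 1) n)) hD le_rfl
  have hlast : Fin.ofNat (k + 1) k = Fin.last k := by ext; simp
  simpa only [hlast, Fin.ofNat_zero] using h

lemma not_odd_of_isInducedCycle {g : V → Bool} (hg : TotalProper G g) {k : ℕ}
    {c : ZMod k → V} (hc : IsInducedCycle G k c) : ¬ Odd k := by
  have h := color_eq_iff_even_of_adj hg (D := fun n => c n) (N := k)
    (fun n _ => by simpa using hc.2.2.1 n) le_rfl
  simpa using h

/-- The walk following a sequence of adjacent vertices. -/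
lemma exists_walk_of_adj {D : ℕ → V} (hD : ∀ n, G.Adj (D n) (D (n + 1))) (a n : ℕ) :
    ∃ w : G.Walk (D a) (D (a + n)), w.length = n := by
  induction n with
  | zero => exact ⟨Walk.nil, rfl⟩
  | succ n ih =>
    obtain ⟨w, hw⟩ := ih
    exact ⟨w.concat (hD (a + n)), by simp [hw]⟩

/-- `D` runs periodically around a closed walk whose length `k` is the odd girth of `G`. -/
structure IsShortestOddLoop (G : SimpleGraph V) (k : ℕ) (D : ℕ → V) : Prop where
  odd : Odd k
  adj : ∀ n, G.Adj (D n) (D (n + 1))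
  periodic : ∀ n, D (n + k) = D n
  le_length : ∀ u (w : G.Walk u u), Odd w.length → k ≤ w.length

namespace IsShortestOddLoop

variable {k : ℕ} {D : ℕ → V}

lemma shift (h : IsShortestOddLoop G k D) (s : ℕ) :
    IsShortestOddLoop G k (fun n => D (s + n)) where
  odd := h.odd
  adj n := h.adj (s + n)
  periodic n := by rw [← add_assoc, h.periodic]
  le_length := h.le_length

lemma ne (h : IsShortestOddLoop G k D) {a b : ℕ} (hab : a < b) (hba : b < a + k) :
    D a ≠ D b := by
  intro he
  obtain ⟨n, rfl⟩ := Nat.exists_eq_add_of_lt hab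
  obtain ⟨w, hw⟩ := exists_walk_of_adj h.adj a (n + 1)
  obtain ⟨m, hm⟩ := Nat.exists_eq_add_of_lt hba
  obtain ⟨w', hw'⟩ := exists_walk_of_adj h.adj (a + n + 1) (m + 1)
  have hper : D (a + n + 1 + (m + 1)) = D a := by
    rw [← h.periodic a, hm]; rfl
  have h₁ := h.le_length _ (w.copy rfl he.symm)
  have h₂ := h.le_length _ (w'.copy he.symm hper)
  have := h.odd
  simp only [Walk.length_copy, hw, hw'] at h₁ h₂
  grind

lemma not_adj (h : IsShortestOddLoop G k D) {a b : ℕ} (hab : a + 1 < b) (hba : b + 1 < a + k) :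
    ¬ G.Adj (D a) (D b) := by
  intro he
  obtain ⟨n, rfl⟩ := Nat.exists_eq_add_of_lt hab
  obtain ⟨w, hw⟩ := exists_walk_of_adj h.adj a (n + 2)
  obtain ⟨m, hm⟩ := Nat.exists_eq_add_of_lt hba
  obtain ⟨w', hw'⟩ := exists_walk_of_adj h.adj (a + 1 + n + 1) (m + 2)
  have hb : D (a + (n + 2)) = D (a + 1 + n + 1) := by congr 1; lia
  have hper : D (a + 1 + n + 1 + (m + 2)) = D a := by
    rw [← h.periodic a, hm]; congr 1; lia
  have h₁ := h.le_length _ ((w.copy rfl hb).concat he.symm)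
  have h₂ := h.le_length _ ((w'.copy rfl hper).concat he)
  have := h.odd
  simp only [Walk.length_concat, Walk.length_copy, hw, hw'] at h₁ h₂
  grind

lemma three_le (h : IsShortestOddLoop G k D) : 3 ≤ k := by
  obtain ⟨m, rfl⟩ := h.odd
  rcases m with _ | m
  · have := h.adj 0
    rw [show D (0 + 1) = D 0 from h.periodic 0] at this
    exact absurd this (G.irrefl)
  · lia

lemma apply_val_natCast [NeZero k] (h : IsShortestOddLoop G k D) (n : ℕ) :
    D (n : ZMod k).val = D n := by
  have hp : Function.Periodic D k := h.periodic
  rw [ZMod.val_natCast, hp.map_mod_nat]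

lemma isInducedCycle (h : IsShortestOddLoop G k D) :
    IsInducedCycle G k (fun i => D i.val) := by
  have h3 := h.three_le
  have : NeZero k := ⟨by lia⟩
  have key : ∀ i j : ZMod k, i.val < j.val → j ≠ i + 1 → i ≠ j + 1 →
      ¬ G.Adj (D i.val) (D j.val) := by
    intro i j hij h₁ h₂
    have hj := j.val_lt
    refine h.not_adj (lt_of_le_of_ne hij fun e => h₁ ?_) (lt_of_le_of_ne (by lia) fun e => h₂ ?_)
    · have := congrArg (Nat.cast (R := ZMod k)) e
      simpa using this.symm
    · have := congrArg (Nat.cast (R := ZMod k)) e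
      simpa using this.symm
  refine ⟨h3, fun i j hij => ?_, fun i => ?_, fun i j hij h₁ h₂ => ?_⟩
  · have hi := i.val_lt
    have hj := j.val_lt
    apply ZMod.val_injective k
    rcases lt_trichotomy i.val j.val with hlt | heq | hgt
    · exact absurd hij (h.ne hlt (by lia))
    · exact heq
    · exact absurd hij.symm (h.ne hgt (by lia))
  · have := h.apply_val_natCast (i.val + 1)
    simp only [Nat.cast_add, ZMod.natCast_val, ZMod.cast_id', id_eq, Nat.cast_one] at this
    simpa only [this] using h.adj i.val
  · rcases lt_or_gt_of_ne fun e => hij (ZMod.val_injective k e) with hlt | hgt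
    · exact key i j hlt h₁ h₂
    · exact fun e => key j i hgt h₂ h₁ e.symm

lemma isInducedPath (h : IsShortestOddLoop G k D) (m : ℕ) {l : ℕ} (hl : l + 1 < k) :
    IsInducedPath G l (fun i => D (m + i.val)) := by
  refine ⟨fun i j hij => ?_, fun i => h.adj (m + i), fun i j hij => h.not_adj (by lia) (by lia)⟩
  have hi := i.isLt
  have hj := j.isLt
  rcases lt_trichotomy i.val j.val with hlt | heq | hgt
  · exact absurd hij (h.ne (by lia) (by lia))
  · exact Fin.ext heq
  · exact absurd hij.symm (h.ne (by lia) (by lia))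

end IsShortestOddLoop

/-- A graph that is not 2-colorable contains a shortest odd closed walk. -/
lemma exists_isShortestOddLoop (h : ¬ G.Colorable 2) : ∃ k D, IsShortestOddLoop G k D := by
  classical
  have hex : ∃ k u, ∃ w : G.Walk u u, Odd k ∧ w.length = k := by
    by_contra! hno
    refine h (two_colorable_iff_forall_loop_even.2 fun u w => ?_)
    by_contra hodd
    exact hno _ u w (Nat.not_even_iff_odd.1 hodd) rfl
  obtain ⟨u, w, hodd, hw⟩ := Nat.find_spec hex
  set k := Nat.find hex
  have hpos : 0 < k := hodd.pos
  refine ⟨k, fun n => w.getVert (n % k), hodd, fun n => ?_, fun n => by simp, fun v w' hw' => ?_⟩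
  · have hlt := Nat.mod_lt n hpos
    have hadj := w.adj_getVert_succ (i := n % k) (by lia)
    rcases Nat.lt_or_ge (n % k + 1) k with hs | hs
    · rwa [Nat.add_mod_of_add_mod_lt (by rwa [Nat.mod_eq_of_lt (by lia : 1 < k)]),
        Nat.mod_eq_of_lt (by lia : 1 < k)]
    · have e : n % k + 1 = k := by lia
      have e' : (n + 1) % k = 0 := by
        rw [← Nat.mod_add_mod, e, Nat.mod_self]
      rw [e, ← hw, Walk.getVert_length] at hadj
      simpa [e', hw] using hadj
  · exact Nat.find_min' hex ⟨v, w', hw', rfl⟩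

end SimpleGraph

open SimpleGraph

section Obstructions

variable {V : Type*} {G : SimpleGraph V} {f : V → Option Bool}

/-- No induced path with uncolored interior has endpoints whose colors contradict the parity of
its length. -/
def PathCompatible (G : SimpleGraph V) (f : V → Option Bool) : Prop :=
  ∀ (k : ℕ) (p : Fin (k + 1) → V), IsInducedPath G k p →
    (∀ i : Fin (k + 1), 0 < i.val → i.val < k → f (p i) = none) →
    ∀ c₁ c₂ : Bool, f (p 0) = some c₁ → f (p (Fin.last k)) = some c₂ → (c₂ = c₁ ↔ Even k)

/-- In a connected 2-colorable graph, a path-compatible partial coloring extends. -/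
lemma exists_extension_of_colorable (hconn : G.Connected) (hcol : G.Colorable 2)
    (hpath : PathCompatible G f) : ∃ g : V → Bool, TotalProper G g ∧ ExtendsColoring f g := by
  classical
  obtain ⟨g, hg⟩ : ∃ g : V → Bool, TotalProper G g :=
    let C := hcol.toColoring (α := Bool) (by simp)
    ⟨C, fun _ _ h => C.valid h⟩
  by_contra hno
  have hex : ∃ n u v, ∃ w : G.Walk u v,
      w.length = n ∧ f u = some (g u) ∧ f v = some (!g v) := by
    have h₁ : ∃ v, f v = some (!g v) := by
      by_contra! h
      refine hno ⟨g, hg, fun v c hc => ?_⟩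
      have := h v
      rw [hc] at this
      cases c <;> cases e : g v <;> simp_all
    have h₂ : ∃ u, f u = some (g u) := by
      by_contra! h
      refine hno ⟨fun v => !g v, fun u v huv => by simpa using hg u v huv, fun v c hc => ?_⟩
      have := h v
      rw [hc] at this
      cases c <;> cases e : g v <;> simp_all
    obtain ⟨v, hv⟩ := h₁
    obtain ⟨u, hu⟩ := h₂
    obtain ⟨w⟩ := hconn.preconnected u v
    exact ⟨_, u, v, w, rfl, hu, hv⟩
  obtain ⟨u, v, w, hw, hu, hv⟩ := Nat.find_spec hex
  have hmin : ∀ u' v' (w' : G.Walk u' v'), f u' = some (g u') → f v' = some (!g v') →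
      Nat.find hex ≤ w'.length :=
    fun u' v' w' hu' hv' => Nat.find_min' hex ⟨u', v', w', rfl, hu', hv'⟩
  generalize Nat.find hex = n at hw hmin
  have hind : IsInducedPath G n (fun i => w.getVert i.val) := by
    have hne : ∀ i j, i < j → j ≤ n → w.getVert i ≠ w.getVert j := by
      intro i j hij hj he
      have := hmin u v ((w.take i).append ((w.drop j).copy he.symm rfl)) hu hv
      simp at this
      lia
    refine ⟨fun i j hij => ?_, fun i => w.adj_getVert_succ (by simp; lia), fun i j hij he => ?_⟩
    · rcases lt_trichotomy i.val j.val with hlt | heq | hgt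
      · exact absurd hij (hne _ _ hlt (by lia))
      · exact Fin.ext heq
      · exact absurd hij.symm (hne _ _ hgt (by lia))
    · have := hmin u v ((w.take i).append (Walk.cons he (w.drop j))) hu hv
      simp at this
      lia
  have hint : ∀ i : Fin (n + 1), 0 < i.val → i.val < n → f (w.getVert i.val) = none := by
    intro i hi hin
    by_contra hc
    obtain ⟨c, hc⟩ := Option.ne_none_iff_exists'.1 hc
    by_cases hcg : c = g (w.getVert i)
    · have := hmin _ _ (w.drop i) (hcg ▸ hc) hv
      simp at this
      lia
    · have := hmin _ _ (w.take i) hu (by rw [hc]; revert hcg; cases c <;> simp)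
      simp at this
      lia
  have h₁ := hpath n _ hind hint (g u) (!g v) (by simpa using hu) (by simpa [← hw] using hv)
  have h₂ := color_last_eq_iff_even hg hind
  rw [← h₁] at h₂
  simp only [Fin.val_last, ← hw, Walk.getVert_length, Fin.val_zero, Walk.getVert_zero] at h₂
  revert h₂
  cases g u <;> cases g v <;> simp

/-- If the partial coloring is path-compatible, then a graph that is not 2-colorable contains
an induced odd cycle whose colored vertices are none, one, or two adjacent ones. -/
lemma exists_odd_cycle_of_not_colorable (hf : PartialProper G f) (hpath : PathCompatible G f)
    (hcol : ¬ G.Colorable 2) :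
    ∃ (k : ℕ) (c : ZMod k → V), Odd k ∧ IsInducedCycle G k c ∧
      ((∀ i, f (c i) = none) ∨
        (∃ i₀, (f (c i₀)).isSome = true ∧ ∀ i, i ≠ i₀ → f (c i) = none) ∨
        ∃ i₀, (f (c i₀)).isSome = true ∧ (f (c (i₀ + 1))).isSome = true ∧
          ∀ i, i ≠ i₀ → i ≠ i₀ + 1 → f (c i) = none) := by
  classical
  obtain ⟨k, D₀, hD₀⟩ := exists_isShortestOddLoop hcol
  by_cases hnone : ∀ n, f (D₀ n) = none
  · exact ⟨k, _, hD₀.odd, hD₀.isInducedCycle, Or.inl fun i => hnone _⟩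
  push Not at hnone
  obtain ⟨s, hs⟩ := hnone
  obtain ⟨c₀, hs⟩ := Option.ne_none_iff_exists'.1 hs
  by_contra! hno
  -- Rotate the cycle so that it starts at a colored vertex.
  obtain ⟨D, hD, h0⟩ : ∃ D, IsShortestOddLoop G k D ∧ f (D 0) = some c₀ :=
    ⟨_, hD₀.shift s, hs⟩
  have h3 := hD.three_le
  have : NeZero k := ⟨by lia⟩
  obtain ⟨-, hno₁, hno₂⟩ := hno k _ hD.odd hD.isInducedCycle
  have step : ∀ m n, m < n → n ≤ k → ∀ c₁ c₂, f (D m) = some c₁ → f (D n) = some c₂ →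
      (∀ j, m < j → j < n → f (D j) = none) → (c₂ = c₁ ↔ Even (n - m)) := by
    intro m n hmn hnk c₁ c₂ hm hn hbetween
    obtain ⟨l, rfl⟩ := Nat.exists_eq_add_of_lt hmn
    rcases Nat.eq_zero_or_pos l with rfl | hlpos
    · have hne : c₂ ≠ c₁ := fun e => hf _ _ (hD.adj m) c₁ hm (e ▸ hn)
      simpa using hne
    rcases Nat.lt_or_ge (l + 2) k with hl | hl
    · have := hpath (l + 1) _ (hD.isInducedPath m hl)
        (fun i hi hi' => hbetween _ (by lia) (by lia)) c₁ c₂ hm hn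
      rwa [show m + l + 1 - m = l + 1 by lia]
    exfalso
    -- Only `D m` and `D (m + l + 1)` are colored; they are adjacent, or equal if `l + 1 = k`.
    rcases Nat.lt_or_ge (l + 1) k with hl' | hl'
    · have hcast : ((m + l + 1 : ℕ) : ZMod k) + 1 = (m : ℕ) := by
        rw [← Nat.cast_add_one, show m + l + 1 + 1 = m + k by lia]
        simp
      obtain ⟨i, hi, hi', hi''⟩ := hno₂ ((m + l + 1 : ℕ) : ZMod k)
        (by rw [hD.apply_val_natCast, hn]; rfl)
        (by rw [hcast, hD.apply_val_natCast, hm]; rfl)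
      rw [hcast] at hi'
      have hlt := i.val_lt
      have hne : i.val ≠ m := by rintro rfl; simp at hi'
      refine hi'' ?_
      rcases Nat.lt_or_ge m i.val with h | h
      · have hne' : i.val ≠ m + l + 1 := by intro e; rw [← e] at hi; simp at hi
        exact hbetween _ h (by lia)
      · rw [← hD.periodic]
        refine hbetween _ (by lia) (lt_of_le_of_ne (by lia) fun e => hi ?_)
        rw [← e]
        simp
    · obtain ⟨i, hi, hi'⟩ := hno₁ 0 (by simp [h0])
      have hlt := i.val_lt
      have : i.val ≠ 0 := by simpa using hi
      exact hi' (hbetween _ (by lia) (by lia))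
  have key : ∀ n ≤ k, ∀ c, f (D n) = some c → (c = c₀ ↔ Even n) := by
    intro n
    induction n using Nat.strong_induction_on with
    | _ n ih =>
      intro hnk c hc
      rcases Nat.eq_zero_or_pos n with rfl | hpos
      · simp_all
      have hP : f (D 0) ≠ none := by simp [h0]
      set m := Nat.findGreatest (fun j => f (D j) ≠ none) (n - 1)
      have hmn : m ≤ n - 1 := Nat.findGreatest_le _
      have hmc : f (D m) ≠ none :=
        Nat.findGreatest_spec (P := fun j => f (D j) ≠ none) (Nat.zero_le _) hP
      obtain ⟨c', hc'⟩ := Option.ne_none_iff_exists'.1 hmc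
      have h₁ := ih m (by lia) (by lia) c' hc'
      have h₂ := step m n (by lia) hnk c' c hc' hc fun j hj hjn =>
        not_not.1 (Nat.findGreatest_is_greatest hj (by lia))
      rw [Nat.even_sub (by lia), ← h₁] at h₂
      have hbool : c = c' ↔ (c = c₀ ↔ c' = c₀) := by
        cases c <;> cases c' <;> cases c₀ <;> simp
      tauto
  have := key k le_rfl c₀ (by rw [← h0, ← hD.periodic 0, zero_add])
  exact Nat.not_even_iff_odd.2 hD.odd (this.1 rfl)

end Obstructions

/-- A partial proper 2-coloring of a finite connected graph extends to a total proper
2-coloring if and only if there is no even induced path whose only colored vertices are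
its endpoints, colored distinctly; no odd induced path whose only colored vertices are
its endpoints, colored alike; no uncolored induced odd cycle; no induced odd cycle with
exactly one colored vertex; and no induced odd cycle with exactly two colored vertices
which are adjacent. -/
theorem partial_proper_two_coloring_extension {V : Type*} [Fintype V] (G : SimpleGraph V)
    (hconn : G.Connected) (f : V → Option Bool) (hf : PartialProper G f) :
    (∃ g : V → Bool, TotalProper G g ∧ ExtendsColoring f g) ↔
      ((¬ ∃ (k : ℕ) (p : Fin (k + 1) → V), Even k ∧ IsInducedPath G k p ∧
          (∀ i : Fin (k + 1), 0 < i.val → i.val < k → f (p i) = none) ∧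
          (∃ c₁ c₂ : Bool, f (p 0) = some c₁ ∧ f (p (Fin.last k)) = some c₂ ∧ c₁ ≠ c₂)) ∧
       (¬ ∃ (k : ℕ) (p : Fin (k + 1) → V), Odd k ∧ IsInducedPath G k p ∧
          (∀ i : Fin (k + 1), 0 < i.val → i.val < k → f (p i) = none) ∧
          (∃ c : Bool, f (p 0) = some c ∧ f (p (Fin.last k)) = some c)) ∧
       (¬ ∃ (k : ℕ) (c : ZMod k → V), Odd k ∧ IsInducedCycle G k c ∧
          ∀ i : ZMod k, f (c i) = none) ∧
       (¬ ∃ (k : ℕ) (c : ZMod k → V), Odd k ∧ IsInducedCycle G k c ∧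
          ∃ i₀ : ZMod k, (f (c i₀)).isSome = true ∧
            ∀ i : ZMod k, i ≠ i₀ → f (c i) = none) ∧
       (¬ ∃ (k : ℕ) (c : ZMod k → V), Odd k ∧ IsInducedCycle G k c ∧
          ∃ i₀ : ZMod k, (f (c i₀)).isSome = true ∧ (f (c (i₀ + 1))).isSome = true ∧
            ∀ i : ZMod k, i ≠ i₀ → i ≠ i₀ + 1 → f (c i) = none)) := by
  constructor
  · rintro ⟨g, hg, hfg⟩
    refine ⟨?_, ?_, ?_, ?_, ?_⟩
    · rintro ⟨k, p, hk, hp, -, c₁, c₂, h₁, h₂, hne⟩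
      have h := (color_last_eq_iff_even hg hp).2 hk
      rw [hfg _ _ h₁, hfg _ _ h₂] at h
      exact hne h.symm
    · rintro ⟨k, p, hk, hp, -, c, h₁, h₂⟩
      refine Nat.not_even_iff_odd.2 hk ((color_last_eq_iff_even hg hp).1 ?_)
      rw [hfg _ _ h₁, hfg _ _ h₂]
    all_goals
      rintro ⟨k, c, hk, hc, -⟩
      exact not_odd_of_isInducedCycle hg hc hk
  · rintro ⟨h₁, h₂, h₃, h₄, h₅⟩
    have hpath : PathCompatible G f := by
      intro k p hp hint c₁ c₂ hc₁ hc₂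
      refine ⟨fun he => ?_, fun hk => ?_⟩
      · by_contra hk
        exact h₂ ⟨k, p, Nat.not_even_iff_odd.1 hk, hp, hint, c₁, hc₁, he ▸ hc₂⟩
      · by_contra hne
        exact h₁ ⟨k, p, hk, hp, hint, c₁, c₂, hc₁, hc₂, Ne.symm hne⟩
    refine exists_extension_of_colorable hconn ?_ hpath
    by_contra hcol
    obtain ⟨k, c, hk, hc, h | h | h⟩ := exists_odd_cycle_of_not_colorable hf hpath hcol
    exacts [h₃ ⟨k, c, hk, hc, h⟩, h₄ ⟨k, c, hk, hc, h⟩, h₅ ⟨k, c, hk, hc, h⟩]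
end

section
/- A (0,1)-matrix is nested if and only if it contains no submatrix equal, up to permutations of rows and columns, to the 0-gem, i.e. the 2x3 matrix with rows (1 1 0) and (0 1 1). -/
/-- `B` equals a submatrix of `A` up to permutations of rows and columns. -/
def ContainsSub {m n p q : ℕ} (A : Fin m → Fin n → Bool) (B : Fin p → Fin q → Bool) : Prop :=
  ∃ (f : Fin p → Fin m) (g : Fin q → Fin n),
    Function.Injective f ∧ Function.Injective g ∧ ∀ i j, B i j = A (f i) (g j)

/-- The consecutive-ones property (for rows, under some column permutation). -/
def HasC1P {m n : ℕ} (A : Fin m → Fin n → Bool) : Prop :=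
  ∃ σ : Equiv.Perm (Fin n), ∀ i : Fin m, ∀ a b c : Fin n, a ≤ b → b ≤ c →
    A i (σ a) = true → A i (σ c) = true → A i (σ b) = true

/-- Two rows are disjoint: they share no 1-column. -/
def RowsDisjoint {m n : ℕ} (A : Fin m → Fin n → Bool) (i k : Fin m) : Prop :=
  ∀ j, ¬(A i j = true ∧ A k j = true)

/-- Two rows are nested: the 1-columns of one are contained in those of the other. -/
def RowsNested {m n : ℕ} (A : Fin m → Fin n → Bool) (i k : Fin m) : Prop :=
  (∀ j, A i j = true → A k j = true) ∨ (∀ j, A k j = true → A i j = true)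

/-- A (0,1)-matrix is nested: it has the C1P and every two rows are disjoint or nested. -/
def IsNested {m n : ℕ} (A : Fin m → Fin n → Bool) : Prop :=
  HasC1P A ∧ ∀ i k : Fin m, i ≠ k → RowsDisjoint A i k ∨ RowsNested A i k

/-- The 0-gem. -/
def gem0 : Fin 2 → Fin 3 → Bool := ![![true, true, false], ![false, true, true]]

/-- If two functions agree up to `k`, then every function lexicographically between them takes the
same value at `k`. -/
theorem Pi.toLex_apply_eq_of_le_of_le {ι α : Type*} [LinearOrder ι] [WellFoundedLT ι]
    [LinearOrder α] {x y z : ι → α} (hxy : toLex x ≤ toLex y) (hyz : toLex y ≤ toLex z) {k : ι}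
    (h : ∀ j ≤ k, x j = z j) : y k = x k := by
  rcases hxy.eq_or_lt with hxy | ⟨p, hp, hxyp⟩
  · rw [toLex.injective hxy]
  by_contra hne
  have hpk : p ≤ k := not_lt.1 fun hkp => hne (hp k hkp).symm
  have hxyp : x p < y p := hxyp
  have hxzp := h p hpk
  rcases hyz.eq_or_lt with hyz | ⟨q, hq, hyzq⟩
  · rw [toLex.injective hyz, hxzp] at hxyp
    exact hxyp.false
  have hyzq : y q < z q := hyzq
  rcases lt_trichotomy q p with hqp | rfl | hpq
  · have hxyq : x q = y q := hp q hqp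
    rw [← hxyq, h q (hqp.le.trans hpk)] at hyzq
    exact hyzq.false
  · exact (hxyp.trans hyzq).ne hxzp
  · have hyzp : y p = z p := hq p hpq
    exact hxyp.ne (hxzp.trans hyzp.symm)

/-- A matrix whose rows are pairwise disjoint or nested has the consecutive-ones property: sort the
rows by decreasing size, then the columns lexicographically. -/
theorem hasC1P_of_disjoint_or_nested {m n : ℕ} (A : Fin m → Fin n → Bool)
    (h : ∀ i k : Fin m, i ≠ k → RowsDisjoint A i k ∨ RowsNested A i k) : HasC1P A := by
  let ones (i : Fin m) : Finset (Fin n) := {j | A i j = true}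
  let size (i : Fin m) : ℕᵒᵈ := OrderDual.toDual (ones i).card
  let τ := Tuple.sort size
  let key (j : Fin n) : Lex (Fin m → Bool) := toLex fun i => A (τ i) j
  refine ⟨Tuple.sort key, fun i a b c hab hbc ha hc => ?_⟩
  obtain ⟨k, rfl⟩ := τ.surjective i
  have hmono := Tuple.monotone_sort key
  refine (Pi.toLex_apply_eq_of_le_of_le (hmono hab) (hmono hbc) (k := k) fun j hjk => ?_).trans ha
  rcases eq_or_ne j k with rfl | hne
  · rw [ha, hc]
  have hcard : (ones (τ k)).card ≤ (ones (τ j)).card := Tuple.monotone_sort size hjk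
  rcases h (τ j) (τ k) (τ.injective.ne hne) with hd | hsub | hsup
  · rw [Bool.eq_false_iff.2 fun hj => hd _ ⟨hj, ha⟩, Bool.eq_false_iff.2 fun hj => hd _ ⟨hj, hc⟩]
  · have heq : ones (τ j) = ones (τ k) :=
      Finset.eq_of_subset_of_card_le
        (fun x hx => by simpa [ones] using hsub x (by simpa [ones] using hx)) hcard
    have hmem (x : Fin n) (hx : A (τ k) x = true) : A (τ j) x = true := by
      have : x ∈ ones (τ j) := heq ▸ by simpa [ones] using hx
      simpa [ones] using this
    rw [hmem _ ha, hmem _ hc]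
  · rw [hsup _ ha, hsup _ hc]

/-- A (0,1)-matrix is nested if and only if it contains no 0-gem as a submatrix
up to permutations of rows and columns. -/
theorem isNested_iff_no_gem0 {m n : ℕ} (A : Fin m → Fin n → Bool) :
    IsNested A ↔ ¬ ContainsSub A gem0 := by
  constructor
  · rintro ⟨-, h⟩ ⟨f, g, hf, -, hA⟩
    have h00 : true = A (f 0) (g 0) := hA 0 0
    have h01 : true = A (f 0) (g 1) := hA 0 1
    have h02 : false = A (f 0) (g 2) := hA 0 2
    have h10 : false = A (f 1) (g 0) := hA 1 0
    have h11 : true = A (f 1) (g 1) := hA 1 1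
    have h12 : true = A (f 1) (g 2) := hA 1 2
    rcases h (f 0) (f 1) (hf.ne (by decide)) with hd | hsub | hsup
    · exact hd _ ⟨h01.symm, h11.symm⟩
    · exact Bool.false_ne_true (h10.trans (hsub _ h00.symm))
    · exact Bool.false_ne_true (h02.trans (hsup _ h12.symm))
  · intro hgem
    suffices h : ∀ i k : Fin m, i ≠ k → RowsDisjoint A i k ∨ RowsNested A i k from
      ⟨hasC1P_of_disjoint_or_nested A h, h⟩
    intro i k hik
    by_contra hcon
    simp only [RowsDisjoint, RowsNested, not_or, not_forall, not_not, Bool.not_eq_true] at hcon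
    obtain ⟨⟨y, hiy, hky⟩, ⟨x, hix, hkx⟩, z, hkz, hiz⟩ := hcon
    have hxy : x ≠ y := by rintro rfl; simp_all
    have hxz : x ≠ z := by rintro rfl; simp_all
    have hyz : y ≠ z := by rintro rfl; simp_all
    refine hgem ⟨![i, k], ![x, y, z], ?_, ?_, ?_⟩
    · intro a b; fin_cases a <;> fin_cases b <;> simp [hik, hik.symm]
    · intro a b
      fin_cases a <;> fin_cases b <;> simp [hxy, hxz, hyz, hxy.symm, hxz.symm, hyz.symm]
    · intro a b; fin_cases a <;> fin_cases b <;> simp [gem0, *]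
end

section
/- For every odd k >= 5, the matrix F_1(k) is not 2-nested; in fact, there is no assignment of one of two colors to the rows of F_1(k) such that any two rows with the same color are disjoint or nested. -/
/-- A (0,1)-matrix is 2-nested: it has the C1P and its rows can be 2-colored so that
any two rows with the same color are disjoint or nested. -/
def Is2Nested {m n : ℕ} (A : Fin m → Fin n → Bool) : Prop :=
  HasC1P A ∧ ∃ col : Fin m → Bool, ∀ i k : Fin m, i ≠ k → col i = col k →
    RowsDisjoint A i k ∨ RowsNested A i k

/-- The matrix `F_1(k)` (here stated for any `k`; it is used for odd `k ≥ 5`). -/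
def F1 (k : ℕ) : Fin k → Fin (k - 1) → Bool := fun i j =>
  if i.val = 0 then decide (1 ≤ j.val ∧ j.val ≤ k - 2)
  else if i.val = 1 then decide (j.val ≤ k - 3)
  else decide (j.val = k - i.val - 1 ∨ j.val = k - i.val)

/-- Two rows that share a 1-column, each having a 1-column of its own, are neither disjoint nor
nested. -/
theorem not_disjoint_or_nested {m n : ℕ} {A : Fin m → Fin n → Bool} {i k : Fin m}
    (a b c : Fin n) (hai : A i a = true) (hak : A k a = true) (hbi : A i b = true)
    (hbk : A k b = false) (hci : A i c = false) (hck : A k c = true) :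
    ¬ (RowsDisjoint A i k ∨ RowsNested A i k) := by
  rintro (h | h | h)
  · exact h a ⟨hai, hak⟩
  · simpa [hbk] using h b hbi
  · simpa [hci] using h c hck

theorem F1_succ_not_disjoint_or_nested {k : ℕ} (hk : 5 ≤ k) (n : ℕ) (hn : n + 1 < k) :
    ¬ (RowsDisjoint (F1 k) ⟨n, by omega⟩ ⟨n + 1, hn⟩ ∨
      RowsNested (F1 k) ⟨n, by omega⟩ ⟨n + 1, hn⟩) := by
  match n, hn with
  | 0, hn =>
    apply not_disjoint_or_nested ⟨1, by omega⟩ ⟨k - 2, by omega⟩ ⟨0, by omega⟩ <;>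
      simp [F1] <;> omega
  | 1, hn =>
    apply not_disjoint_or_nested ⟨k - 3, by omega⟩ ⟨0, by omega⟩ ⟨k - 2, by omega⟩ <;>
      simp [F1] <;> omega
  | n + 2, hn =>
    apply not_disjoint_or_nested ⟨k - (n + 2) - 1, by omega⟩ ⟨k - (n + 2), by omega⟩
      ⟨k - (n + 2) - 2, by omega⟩ <;> simp [F1] <;> omega

theorem F1_last_not_disjoint_or_nested {k : ℕ} (hk : 5 ≤ k) :
    ¬ (RowsDisjoint (F1 k) ⟨k - 1, by omega⟩ ⟨0, by omega⟩ ∨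
      RowsNested (F1 k) ⟨k - 1, by omega⟩ ⟨0, by omega⟩) := by
  have h0 : k - 1 ≠ 0 := by omega
  have h1 : k - 1 ≠ 1 := by omega
  apply not_disjoint_or_nested ⟨1, by omega⟩ ⟨0, by omega⟩ ⟨2, by omega⟩ <;>
    simp [F1, h0, h1] <;> omega

/-- For every odd `k ≥ 5`, there is no 2-coloring of the rows of `F_1(k)` such that any
two rows with the same color are disjoint or nested; in particular `F_1(k)` is not
2-nested. -/
theorem F1_not_two_nested (k : ℕ) (hk : 5 ≤ k) (hodd : Odd k) :
    (¬ ∃ col : Fin k → Bool, ∀ i j : Fin k, i ≠ j → col i = col j →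
        RowsDisjoint (F1 k) i j ∨ RowsNested (F1 k) i j) ∧ ¬ Is2Nested (F1 k) := by
  have key : ¬ ∃ col : Fin k → Bool, ∀ i j : Fin k, i ≠ j → col i = col j →
      RowsDisjoint (F1 k) i j ∨ RowsNested (F1 k) i j := by
    rintro ⟨col, h⟩
    have step (n : ℕ) (hn : n + 1 < k) : col ⟨n, by omega⟩ ≠ col ⟨n + 1, hn⟩ := fun e =>
      F1_succ_not_disjoint_or_nested hk n hn (h _ _ (by simp) e)
    have even (m : ℕ) (hm : 2 * m < k) : col ⟨2 * m, hm⟩ = col ⟨0, by omega⟩ := by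
      induction m with
      | zero => rfl
      | succ m ih =>
        rw [← ih (by omega)]
        have h₁ := step (2 * m) (by omega)
        have h₂ := step (2 * m + 1) (by omega)
        exact (Bool.eq_not_of_ne h₂.symm).trans (Bool.eq_not_of_ne h₁).symm
    obtain ⟨m, rfl⟩ := hodd
    refine F1_last_not_disjoint_or_nested hk (h _ _ ?_ (even m (by omega)))
    simp only [ne_eq, Fin.mk.injEq]
    omega
  exact ⟨key, fun h => key h.2⟩
end

section
/- For every odd k >= 5, the matrix F_2(k) is not 2-nested; in fact, there is no assignment of one of two colors to the rows of F_2(k) such that any two rows with the same color are disjoint or nested. -/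
/-- The matrix `F_2(k)` (here stated for any `k`; it is used for odd `k ≥ 5`). -/
def F2 (k : ℕ) : Fin k → Fin k → Bool := fun i j =>
  if i.val = 0 then decide (1 ≤ j.val ∧ j.val ≤ k - 2)
  else decide (j.val = i.val - 1 ∨ j.val = i.val)

/-- Rows that share a 1-column, each having a 1-column the other lacks, are neither disjoint
nor nested. -/
theorem not_disjoint_or_nested_of_overlap {m n : ℕ} {A : Fin m → Fin n → Bool} {i j : Fin m}
    (a b c : Fin n) (hai : A i a = true) (haj : A j a = true) (hbi : A i b = true)
    (hbj : A j b = false) (hci : A i c = false) (hcj : A j c = true) :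
    ¬(RowsDisjoint A i j ∨ RowsNested A i j) := by
  rintro (h | h | h)
  · exact h a ⟨hai, haj⟩
  · simp [h b hbi] at hbj
  · simp [h c hcj] at hci

/-- The overlapping pairs of rows of `F2 k` form an odd cycle, so no 2-coloring of the rows
separates all of them. -/
theorem F2_not_exists_coloring (k : ℕ) (hk : 5 ≤ k) (hodd : Odd k) :
    ¬ ∃ col : Fin k → Bool, ∀ i j : Fin k, i ≠ j → col i = col j →
        RowsDisjoint (F2 k) i j ∨ RowsNested (F2 k) i j := by
  rintro ⟨col, h⟩
  have first : col ⟨0, by omega⟩ ≠ col ⟨1, by omega⟩ := fun he =>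
    not_disjoint_or_nested_of_overlap (A := F2 k) ⟨1, by omega⟩ ⟨2, by omega⟩ ⟨0, by omega⟩
      (by simp [F2]; omega) (by simp [F2]) (by simp [F2]; omega) (by simp [F2])
      (by simp [F2]) (by simp [F2]) (h _ _ (by simp) he)
  have last : col ⟨0, by omega⟩ ≠ col ⟨k - 1, by omega⟩ := fun he =>
    have hk₀ : k - 1 ≠ 0 := by omega
    not_disjoint_or_nested_of_overlap (A := F2 k)
      ⟨k - 2, by omega⟩ ⟨1, by omega⟩ ⟨k - 1, by omega⟩
      (by simp [F2]; omega) (by simp [F2, hk₀]; omega) (by simp [F2]; omega)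
      (by simp [F2, hk₀]; omega) (by simp [F2]; omega) (by simp [F2, hk₀])
      (h _ _ (by simp; omega) he)
  have step (i : ℕ) (hi : 1 ≤ i) (hik : i + 1 < k) :
      col ⟨i, by omega⟩ ≠ col ⟨i + 1, hik⟩ := fun he =>
    have hi₀ : i ≠ 0 := by omega
    not_disjoint_or_nested_of_overlap (A := F2 k)
      ⟨i, by omega⟩ ⟨i - 1, by omega⟩ ⟨i + 1, hik⟩
      (by simp [F2, hi₀]) (by simp [F2]) (by simp [F2, hi₀]) (by simp [F2]; omega)
      (by simp [F2, hi₀]; omega) (by simp [F2]) (h _ _ (by simp) he)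
  have even (t : ℕ) (ht : 2 * t + 2 < k) : col ⟨2 * t + 2, ht⟩ = col ⟨0, by omega⟩ := by
    induction t with
    | zero =>
      exact (Bool.eq_not_of_ne (step 1 le_rfl (by omega)).symm).trans
        (Bool.eq_not_of_ne first).symm
    | succ t ih =>
      have h₁ := step (2 * t + 2) (by omega) (by omega)
      have h₂ := step (2 * t + 2 + 1) (by omega) (by omega)
      exact ((Bool.eq_not_of_ne h₂.symm).trans (Bool.eq_not_of_ne h₁).symm).trans
        (ih (by omega))
  obtain ⟨r, rfl⟩ := hodd
  obtain ⟨t, rfl⟩ : ∃ t, r = t + 1 := ⟨r - 1, by omega⟩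
  exact last (even t (by omega)).symm

/-- For every odd `k ≥ 5`, there is no 2-coloring of the rows of `F_2(k)` such that any
two rows with the same color are disjoint or nested; in particular `F_2(k)` is not
2-nested. -/
theorem F2_not_two_nested (k : ℕ) (hk : 5 ≤ k) (hodd : Odd k) :
    (¬ ∃ col : Fin k → Bool, ∀ i j : Fin k, i ≠ j → col i = col j →
        RowsDisjoint (F2 k) i j ∨ RowsNested (F2 k) i j) ∧ ¬ Is2Nested (F2 k) :=
  ⟨F2_not_exists_coloring k hk hodd, fun h => F2_not_exists_coloring k hk hodd h.2⟩
end
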